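/- Assume condition (torte). Then for every λ ∈ ℂ, AE^{-1} − λ = {(E(T z), z + (μ − λ) E(T z)) : z ∈ Y}, and AE^{-1} − λ is a closed linear subspace of Y × Y. -/

import Mathlib

variable {X Y : Type*} [NormedAddCommGroup X] [NormedSpace ℂ X]
  [NormedAddCommGroup Y] [NormedSpace ℂ Y]

/-- The range representation `A E⁻¹ - λ` of the pencil `λ E - A`:
the set `{(E x, A x - λ E x) : x ∈ dom A} ⊆ Y × Y`. -/
def ranRepShift (E : X →L[ℂ] Y) (dom : Submodule ℂ X) (A : ↥dom →ₗ[ℂ] Y)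
    (lam : ℂ) : Set (Y × Y) :=
  {p | ∃ x : ↥dom, p = (E (x : X), A x - lam • E (x : X))}

/-- Under condition (torte), for every `λ ∈ ℂ`,
`A E⁻¹ - λ = {(E (T z), z + (μ - λ) E (T z)) : z ∈ Y}` and `A E⁻¹ - λ` is a closed
linear subspace of `Y × Y`. -/
theorem stmt1 {X Y : Type*}
    [NormedAddCommGroup X] [NormedSpace ℂ X] [CompleteSpace X]
    [NormedAddCommGroup Y] [NormedSpace ℂ Y] [CompleteSpace Y]
    (E : X →L[ℂ] Y) (dom : Submodule ℂ X) (A : ↥dom →ₗ[ℂ] Y)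
    (hdense : Dense (dom : Set X))
    (hgraph : IsClosed {p : X × Y | ∃ x : ↥dom, p = ((x : X), A x)})
    (μ : ℂ) (T : Y →L[ℂ] X)
    (hTdom : ∀ y : Y, T y ∈ dom)
    (hT1 : ∀ y : Y, A ⟨T y, hTdom y⟩ - μ • E (T y) = y)
    (hT2 : ∀ x : ↥dom, T (A x - μ • E (x : X)) = (x : X)) :
    ∀ lam : ℂ,
      ranRepShift E dom A lam
        = {p : Y × Y | ∃ z : Y, p = (E (T z), z + (μ - lam) • E (T z))} ∧
      IsClosed (ranRepShift E dom A lam) := by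
  intro lam
  have hrange : ranRepShift E dom A lam
      = {p : Y × Y | ∃ z : Y, p = (E (T z), z + (μ - lam) • E (T z))} := by
    ext p
    constructor
    · rintro ⟨x, rfl⟩
      refine ⟨A x - μ • E (x : X), ?_⟩
      rw [hT2 x, sub_smul, sub_add_sub_cancel]
    · rintro ⟨z, rfl⟩
      refine ⟨⟨T z, hTdom z⟩, ?_⟩
      rw [sub_eq_iff_eq_add.mp (hT1 z), sub_smul, add_sub_assoc]
  refine ⟨hrange, ?_⟩
  have hequation : {p : Y × Y | ∃ z : Y, p = (E (T z), z + (μ - lam) • E (T z))}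
      = {p : Y × Y | p.1 = E (T (p.2 - (μ - lam) • p.1))} := by
    ext ⟨u, v⟩
    constructor
    · rintro ⟨z, hz⟩
      obtain ⟨rfl, rfl⟩ := Prod.mk.inj hz
      simp only [Set.mem_ofPred_eq, add_sub_cancel_right]
    · intro h
      refine ⟨v - (μ - lam) • u, Prod.ext h ?_⟩
      rw [← show u = E (T (v - (μ - lam) • u)) from h, sub_add_cancel]
  rw [hrange, hequation]
  exact isClosed_eq (by fun_prop) (by fun_prop)
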